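/- arXiv:1403.3521 — 3 statements merged into one kernel-verified Lean document; each statement's English description precedes it below -/
import Mathlib

section
/- Let a, b, f₁₁, f₁₂, f₂₂, R₁, S₁, T₁, R₂, S₂, T₂ be real numbers with (a,b) ≠ (0,0) and with (R₁,S₁,T₁), (R₂,S₂,T₂) linearly independent, and let D = span{(a,b,f₁₁,f₁₂,f₂₂), (0,0,R₁,S₁,T₁), (0,0,R₂,S₂,T₂)} ⊆ ℝ⁵ (a 3-dimensional subspace whose intersection with V₀ is 2-dimensional). Put Dₛₜ = S₁T₂ − S₂T₁, Dᵣₜ = R₁T₂ − R₂T₁, Dᵣₛ = R₁S₂ − R₂S₁, B = (−a·Dₛₜ, a·Dᵣₜ − b·Dₛₜ, b·Dᵣₜ − a·Dᵣₛ, −b·Dᵣₛ) ∈ ℝ⁴ and C = f₁₁·Dₛₜ − f₁₂·Dᵣₜ + f₂₂·Dᵣₛ. Then B ≠ 0, and for every p = (p₁₁₁,p₁₁₂,p₁₂₂,p₂₂₂) ∈ ℝ⁴: L(p) ∩ D ≠ {0} if and only if B₁p₁₁₁ + B₂p₁₁₂ + B₃p₁₂₂ + B₄p₂₂₂ + C =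 0. In particular {p ∈ ℝ⁴ : L(p) ∩ D ≠ {0}} is an affine hyperplane of ℝ⁴. -/
/-- The Lagrangian plane `L(p) = span{(1,0,p₁₁₁,p₁₁₂,p₁₂₂), (0,1,p₁₁₂,p₁₂₂,p₂₂₂)} ⊆ ℝ⁵`. -/
def lagPlane (p111 p112 p122 p222 : ℝ) : Submodule ℝ (Fin 5 → ℝ) :=
  Submodule.span ℝ {![1, 0, p111, p112, p122], ![0, 1, p112, p122, p222]}

/-- The `2 × 2` minors of two linearly independent vectors of `ℝ³` do not all vanish. -/
theorem minors_ne_zero_of_linearIndependent {R1 S1 T1 R2 S2 T2 : ℝ}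
    (hind : LinearIndependent ℝ ![![R1, S1, T1], ![R2, S2, T2]]) :
    ¬(S1 * T2 - S2 * T1 = 0 ∧ R1 * T2 - R2 * T1 = 0 ∧ R1 * S2 - R2 * S1 = 0) := by
  rintro ⟨hst, hrt, hrs⟩
  refine crossProduct_ne_zero_iff_linearIndependent.mpr hind ?_
  rw [cross_apply]
  ext i
  fin_cases i <;> simp <;> linarith

/-- A vector annihilated by the nonzero minors of two vectors of `ℝ³` is a linear combination
of these two vectors. -/
theorem exists_combination_of_minors {R1 S1 T1 R2 S2 T2 X Y Z : ℝ}
    (hne : ¬(S1 * T2 - S2 * T1 = 0 ∧ R1 * T2 - R2 * T1 = 0 ∧ R1 * S2 - R2 * S1 = 0))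
    (h : X * (S1 * T2 - S2 * T1) - Y * (R1 * T2 - R2 * T1) + Z * (R1 * S2 - R2 * S1) = 0) :
    ∃ s t : ℝ, s * R1 + t * R2 = X ∧ s * S1 + t * S2 = Y ∧ s * T1 + t * T2 = Z := by
  obtain ⟨l, hl⟩ : ∃ l, l = S1 * T2 - S2 * T1 := ⟨_, rfl⟩
  obtain ⟨m, hm⟩ : ∃ m, m = R1 * T2 - R2 * T1 := ⟨_, rfl⟩
  obtain ⟨n, hn⟩ : ∃ n, n = R1 * S2 - R2 * S1 := ⟨_, rfl⟩
  rw [← hl, ← hm, ← hn] at hne h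
  have hN : l ^ 2 + m ^ 2 + n ^ 2 ≠ 0 := fun h0 => hne
    ⟨by nlinarith [sq_nonneg l, sq_nonneg m, sq_nonneg n],
      by nlinarith [sq_nonneg l, sq_nonneg m, sq_nonneg n],
      by nlinarith [sq_nonneg l, sq_nonneg m, sq_nonneg n]⟩
  refine ⟨((Y * T2 - Z * S2) * l + (X * T2 - Z * R2) * m + (X * S2 - Y * R2) * n) /
      (l ^ 2 + m ^ 2 + n ^ 2),
    ((S1 * Z - T1 * Y) * l + (R1 * Z - T1 * X) * m + (R1 * Y - S1 * X) * n) /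
      (l ^ 2 + m ^ 2 + n ^ 2), ?_, ?_, ?_⟩ <;> field_simp
  · linear_combination (-l) * h - (Y * l + X * m) * hm + (Z * l - X * n) * hn
  · linear_combination m * h - (Y * l + X * m) * hl - (Z * m + Y * n) * hn
  · linear_combination (-n) * h - (Z * l - X * n) * hl - (Z * m + Y * n) * hm

/-- A 3-dimensional distribution with 2-dimensional vertical part determines a
quasi-linear 3rd-order Monge–Ampère equation, with the explicit coefficients `B`, `C`
of the paper. -/
theorem goursat_quasilinear_explicit
    (a b f11 f12 f22 R1 S1 T1 R2 S2 T2 : ℝ)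
    (hab : ¬(a = 0 ∧ b = 0))
    (hind : LinearIndependent ℝ ![![R1, S1, T1], ![R2, S2, T2]])
    (D : Submodule ℝ (Fin 5 → ℝ))
    (hD : D = Submodule.span ℝ
      {![a, b, f11, f12, f22], ![0, 0, R1, S1, T1], ![0, 0, R2, S2, T2]})
    (Dst Drt Drs : ℝ)
    (hDst : Dst = S1 * T2 - S2 * T1)
    (hDrt : Drt = R1 * T2 - R2 * T1)
    (hDrs : Drs = R1 * S2 - R2 * S1)
    (B : Fin 4 → ℝ)
    (hB : B = ![-a * Dst, a * Drt - b * Dst, b * Drt - a * Drs, -b * Drs])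
    (C : ℝ)
    (hC : C = f11 * Dst - f12 * Drt + f22 * Drs) :
    B ≠ 0 ∧
    ∀ p111 p112 p122 p222 : ℝ,
      lagPlane p111 p112 p122 p222 ⊓ D ≠ ⊥ ↔
      B 0 * p111 + B 1 * p112 + B 2 * p122 + B 3 * p222 + C = 0 := by
  have hne := minors_ne_zero_of_linearIndependent hind
  subst hD hB hC
  refine ⟨fun hB => ?_, fun p111 p112 p122 p222 => ?_⟩
  · have h0 := congrFun hB 0
    have h1 := congrFun hB 1
    have h2 := congrFun hB 2
    have h3 := congrFun hB 3
    simp at h0 h1 h2 h3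
    rw [← hDst, ← hDrt, ← hDrs] at hne
    grind
  · simp only [lagPlane, Submodule.ne_bot_iff, Submodule.mem_inf, Submodule.mem_span_pair,
      Submodule.mem_span_triple]
    subst hDst hDrt hDrs
    constructor
    · rintro ⟨v, ⟨⟨x, y, rfl⟩, c, s, t, h⟩, hv⟩
      have h0 := congrFun h 0
      have h1 := congrFun h 1
      have h2 := congrFun h 2
      have h3 := congrFun h 3
      have h4 := congrFun h 4
      simp at h0 h1 h2 h3 h4 ⊢
      subst h0 h1
      have hc : c ≠ 0 := by
        rintro rfl
        simp at hv
      refine mul_left_cancel₀ hc ?_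
      linear_combination (S1 * T2 - S2 * T1) * h2 - (R1 * T2 - R2 * T1) * h3 +
        (R1 * S2 - R2 * S1) * h4
    · intro h
      simp at h
      obtain ⟨s, t, h2, h3, h4⟩ := exists_combination_of_minors
        (X := a * p111 + b * p112 - f11) (Y := a * p112 + b * p122 - f12)
        (Z := a * p122 + b * p222 - f22) hne (by linear_combination -h)
      refine ⟨_, ⟨⟨a, b, rfl⟩, 1, s, t, ?_⟩, fun h0 => hab ?_⟩
      · ext i
        fin_cases i <;> simp <;> linarith
      · exact ⟨by simpa using congrFun h0 0, by simpa using congrFun h0 1⟩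
end

section
/- Let a, b, c, d, e, h, k be real numbers with a ≠ 0, h ≠ 0, k ≠ 0 and a·h³ − b·h²k + c·hk² − d·k³ = 0, and let D = span{(1, h/k, −e/a, 0, 0), (0, 0, h/k − b/a, 1, 0), (0, 0, (k·d)/(h·a), 0, −1)} ⊆ ℝ⁵ (a 3-dimensional subspace). Then for every p = (p₁₁₁,p₁₁₂,p₁₂₂,p₂₂₂) ∈ ℝ⁴: L(p) ∩ D ≠ {0} if and only if a·p₁₁₁ + b·p₁₁₂ + c·p₁₂₂ + d·p₂₂₂ + e = 0. -/
/-- If `h / k` is a root of the dehomogenized symbol, then the compatibility condition for a vector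
of the Goursat distribution to lie in a Lagrangian plane is the quasi-linear equation itself. -/
theorem goursat_condition_iff {a b c d e h k : ℝ}
    (ha : a ≠ 0) (hh : h ≠ 0) (hk : k ≠ 0)
    (hroot : a * h ^ 3 - b * h ^ 2 * k + c * h * k ^ 2 - d * k ^ 3 = 0) (p q r s : ℝ) :
    -e / a + (h / k - b / a) * (q + h / k * r) - (k * d) / (h * a) * (r + h / k * s)
        = p + h / k * q ↔
      a * p + b * q + c * r + d * s + e = 0 := by
  have key : a * (-e / a + (h / k - b / a) * (q + h / k * r)
      - (k * d) / (h * a) * (r + h / k * s) - (p + h / k * q))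
      = -(a * p + b * q + c * r + d * s + e) := by
    field_simp
    linear_combination r * hroot
  rw [← sub_eq_zero, ← mul_right_inj' ha, key, mul_zero, neg_eq_zero]

/-- Every quasi-linear 3rd-order PDE `a·p₁₁₁ + b·p₁₁₂ + c·p₁₂₂ + d·p₂₂₂ + e = 0`
is a Goursat-type MAE `𝓔_D` for the explicit 3-dimensional distribution `D` built
from the root `−h/k` of its symbol. -/
theorem quasilinear_is_goursat (a b c d e h k : ℝ)
    (ha : a ≠ 0) (hh : h ≠ 0) (hk : k ≠ 0)
    (hroot : a * h ^ 3 - b * h ^ 2 * k + c * h * k ^ 2 - d * k ^ 3 = 0)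
    (D : Submodule ℝ (Fin 5 → ℝ))
    (hD : D = Submodule.span ℝ
      {![1, h / k, -e / a, 0, 0],
       ![0, 0, h / k - b / a, 1, 0],
       ![0, 0, (k * d) / (h * a), 0, -1]}) :
    ∀ p111 p112 p122 p222 : ℝ,
      lagPlane p111 p112 p122 p222 ⊓ D ≠ ⊥ ↔
      a * p111 + b * p112 + c * p122 + d * p222 + e = 0 := by
  intro p q r s
  rw [← goursat_condition_iff ha hh hk hroot, Submodule.ne_bot_iff]
  subst hD
  simp only [lagPlane, Submodule.mem_inf, Submodule.mem_span_pair, Submodule.mem_span_triple]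
  constructor
  · rintro ⟨v, ⟨⟨x, y, rfl⟩, u, m, n, huv⟩, hv⟩
    have h0 := congrFun huv 0
    have h1 := congrFun huv 1
    have h2 := congrFun huv 2
    have h3 := congrFun huv 3
    have h4 := congrFun huv 4
    simp at h0 h1 h2 h3 h4
    subst h0
    have hu : u ≠ 0 := by
      rintro rfl
      apply hv
      simp [← h1]
    apply mul_left_cancel₀ hu
    linear_combination h2 - (h / k - b / a) * h3 + (k * d) / (h * a) * h4
      + (q - (h / k - b / a) * r + (k * d) / (h * a) * s) * (-h1)
  · intro hp
    refine ⟨_, ⟨⟨1, h / k, rfl⟩, 1, q + h / k * r, -(r + h / k * s), ?_⟩, fun h0 => ?_⟩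
    · ext i
      fin_cases i <;> simp
      linear_combination hp
    · simpa using congrFun h0 0
end

section
/- Let a, b, c, e be real numbers with a ≠ 0, and let D = span{(1, 0, −e/a, 0, 0), (0, 0, −b/a, 1, 0), (0, 0, −c/a, 0, 1)} ⊆ ℝ⁵ (a 3-dimensional subspace). Then for every p = (p₁₁₁,p₁₁₂,p₁₂₂,p₂₂₂) ∈ ℝ⁴: L(p) ∩ D ≠ {0} if and only if a·p₁₁₁ + b·p₁₁₂ + c·p₁₂₂ + e = 0. -/
/-- The `d = 0` case: the quasi-linear 3rd-order PDE
`a·p₁₁₁ + b·p₁₁₂ + c·p₁₂₂ + e = 0` is the Goursat-type MAE `𝓔_D` of the explicit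
3-dimensional distribution `D`. -/
theorem quasilinear_is_goursat_d_zero (a b c e : ℝ) (ha : a ≠ 0)
    (D : Submodule ℝ (Fin 5 → ℝ))
    (hD : D = Submodule.span ℝ
      {![1, 0, -e / a, 0, 0], ![0, 0, -b / a, 1, 0], ![0, 0, -c / a, 0, 1]}) :
    ∀ p111 p112 p122 p222 : ℝ,
      lagPlane p111 p112 p122 p222 ⊓ D ≠ ⊥ ↔
      a * p111 + b * p112 + c * p122 + e = 0 := by
  subst hD
  intro p111 p112 p122 p222
  rw [Submodule.ne_bot_iff]
  constructor
  · rintro ⟨v, ⟨hL, hD⟩, hv⟩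
    obtain ⟨x, y, rfl⟩ := Submodule.mem_span_pair.mp hL
    obtain ⟨u, s, t, h⟩ := Submodule.mem_span_triple.mp hD
    have h0 : u = x := by simpa using congrFun h 0
    have h1 : y = 0 := by simpa using (congrFun h 1).symm
    subst h0 h1
    have h2 := congrFun h 2
    have h3 : s = u * p112 := by simpa using congrFun h 3
    have h4 : t = u * p122 := by simpa using congrFun h 4
    have hu : u ≠ 0 := by
      rintro rfl
      simp at hv
    simp [h3, h4] at h2
    field_simp at h2
    linear_combination -h2
  · intro h
    refine ⟨![1, 0, p111, p112, p122], ⟨Submodule.subset_span (by simp), ?_⟩,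
      fun h0 => by simpa using congrFun h0 0⟩
    refine Submodule.mem_span_triple.mpr ⟨1, p112, p122, ?_⟩
    have hp : -e / a + p112 * (-b / a) + p122 * (-c / a) = p111 := by
      field_simp
      linear_combination -h
    ext i
    fin_cases i <;> simp [hp]
end
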